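/- Overlap of unnormalized q-coherent states: for all real ζ, ζ' with (1−q)|ζζ'| < 1, q(1−q)ζ² < 1 and q(1−q)ζ'² < 1, setting F_ζ(x) = Σ_{n=0}^∞ (ζ^n/√(n!_{q,α})) φ_n^α(x;q), one has (1−q)·Σ_{k∈ℤ} q^{k(2α+2)} [ F_ζ(q^k) F_{ζ'}(q^k) + F_ζ(−q^k) F_{ζ'}(−q^k) ] = Σ_{n=0}^∞ (ζζ')^n / n!_{q,α} = e_{q,α}((1−q)ζζ'), where e_{q,α}(z) = Σ_{k=0}^∞ z^k/(q;q)_{k,α}. -/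

import Mathlib

open scoped BigOperators
open Real Filter

noncomputable section

/-- q-shifted factorial `(a;q)_n`. -/
def qPoch (a q : ℝ) (n : ℕ) : ℝ := ∏ k ∈ Finset.range n, (1 - a * q ^ k)

/-- infinite q-shifted factorial `(a;q)_∞`. -/
def qPochInf (a q : ℝ) : ℝ := ∏' k : ℕ, (1 - a * q ^ k)

/-- q-number `⟦x⟧_q = (1-q^x)/(1-q)`. -/
def qNumber (q x : ℝ) : ℝ := (1 - q ^ x) / (1 - q)

/-- generalized q-integer `⟦n⟧_{q,α}`: equals `⟦n⟧_q` for even `n` and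
`⟦n+2α+1⟧_q` for odd `n` (so `⟦2m+1⟧_{q,α} = ⟦2m+2α+2⟧_q`). -/
def qNumAlpha (q α : ℝ) (n : ℕ) : ℝ :=
  if n % 2 = 0 then qNumber q n else qNumber q (n + 2 * α + 1)

/-- generalized q-factorial `n!_{q,α}`. -/
def qFactAlpha (q α : ℝ) (n : ℕ) : ℝ := ∏ k ∈ Finset.range n, qNumAlpha q α (k + 1)

/-- generalized q-shifted factorial `(q;q)_{n,α} = (1-q)^n n!_{q,α}`. -/
def qPochAlpha (q α : ℝ) (n : ℕ) : ℝ := (1 - q) ^ n * qFactAlpha q α n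

/-- generalized discrete q-Hermite II polynomials `h̃_{n,α}(x;q)`. -/
def hTilde (q α : ℝ) (n : ℕ) (x : ℝ) : ℝ :=
  qPoch q q n * ∑ k ∈ Finset.range (n / 2 + 1),
    (-1 : ℝ) ^ k * q ^ ((k * (2 * k + 1) : ℤ) - (2 * n * k : ℤ)) * x ^ (n - 2 * k) /
      (qPoch (q ^ 2) (q ^ 2) k * qPochAlpha q α (n - 2 * k))

/-- the weight `ω_α(x;q) = e_{q²}(-q^{-2α-1}x²) = 1/∏_{k≥0}(1+q^{-2α-1}x²q^{2k})`. -/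
def omegaAlpha (q α x : ℝ) : ℝ :=
  (∏' k : ℕ, (1 + q ^ (-(2 * α + 1)) * x ^ 2 * q ^ (2 * k)))⁻¹

/-- normalization constant `c_α`. -/
def cAlpha (q α : ℝ) : ℝ :=
  Real.sqrt (qPochInf (-q ^ (-(2 * α + 1))) (q ^ 2) * qPochInf (-q ^ (2 * α + 3)) (q ^ 2) *
      qPochInf (q ^ (2 * α + 2)) (q ^ 2) /
    (2 * (1 - q) *
      (qPochInf (-q) (q ^ 2) * qPochInf (-q) (q ^ 2) * qPochInf (q ^ 2) (q ^ 2))))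

/-- normalization constant `d_{n,α} = c_α q^{n²/2} (q;q)_{n,α}^{1/2} / (q;q)_n`. -/
def dAlpha (q α : ℝ) (n : ℕ) : ℝ :=
  cAlpha q α * q ^ (((n : ℝ) ^ 2) / 2) * Real.sqrt (qPochAlpha q α n) / qPoch q q n

/-- the (q,α)-deformed Hermite functions `φ_n^α(x;q)`. -/
def phiQ (q α : ℝ) (n : ℕ) (x : ℝ) : ℝ :=
  dAlpha q α n * Real.sqrt (omegaAlpha q α x) * hTilde q α n x

/-- parity indicator `θ(n)`: 1 if `n` is odd, 0 if `n` is even. -/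
def theta (n : ℕ) : ℝ := if n % 2 = 1 then 1 else 0

/-- the q-Gamma function `Γ_q(z) = (q;q)_∞ / (q^z;q)_∞ · (1-q)^{1-z}`. -/
def qGammaF (q z : ℝ) : ℝ := qPochInf q q / qPochInf (q ^ z) q * (1 - q) ^ (1 - z)

/-- Rosenblum generalized factorial `γ_ν(n)`. -/
def gammaGen (ν : ℝ) (n : ℕ) : ℝ :=
  2 ^ n * (Nat.factorial (n / 2) : ℝ) *
    Real.Gamma (ν + (((n + 1) / 2 : ℕ) : ℝ) + 1 / 2) / Real.Gamma (ν + 1 / 2)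

/-- generalized Hermite polynomials `H_n^ν(x)`. -/
def HGen (ν : ℝ) (n : ℕ) (x : ℝ) : ℝ :=
  (Nat.factorial n : ℝ) * ∑ k ∈ Finset.range (n / 2 + 1),
    (-1 : ℝ) ^ k * (2 * x) ^ (n - 2 * k) / ((Nat.factorial k : ℝ) * gammaGen ν (n - 2 * k))

/-- Rosenblum generalized Hermite functions `φ_n^ν(x)`. -/
def phiGen (ν : ℝ) (n : ℕ) (x : ℝ) : ℝ :=
  Real.sqrt (gammaGen ν n / Real.Gamma (ν + 1 / 2)) * Real.exp (-x ^ 2 / 2) *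
    HGen ν n x / ((2 : ℝ) ^ ((n : ℝ) / 2) * (Nat.factorial n : ℝ))

/-- symmetric q-number `[x]_s = (s^x - s^{-x})/(s - s^{-1})`. -/
def qNumSym (s x : ℝ) : ℝ := (s ^ x - s ^ (-x)) / (s - s⁻¹)

/-- Euler q-exponential `e_q(z) = Σ z^k/(q;q)_k`. -/
def eExp (q z : ℝ) : ℝ := ∑' k : ℕ, z ^ k / qPoch q q k

/-- generalized q-exponential `E_{q,α}(z) = Σ q^{k(k-1)/2} z^k/(q;q)_{k,α}`. -/
def bigEAlpha (q α z : ℝ) : ℝ := ∑' k : ℕ, q ^ (k * (k - 1) / 2) * z ^ k / qPochAlpha q α k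

/-- generalized q-exponential `e_{q,α}(z) = Σ z^k/(q;q)_{k,α}`. -/
def eExpAlpha (q α z : ℝ) : ℝ := ∑' k : ℕ, z ^ k / qPochAlpha q α k

/-- the unnormalized q-coherent state `F_ζ(x) = Σ_n ζ^n/√(n!_{q,α}) φ_n^α(x;q)`. -/
def coherentF (q α ζ x : ℝ) : ℝ :=
  ∑' n : ℕ, ζ ^ n / Real.sqrt (qFactAlpha q α n) * phiQ q α n x

open scoped Topology

lemma qPoch_zero' (a Q : ℝ) : qPoch a Q 0 = 1 := by simp [qPoch]

lemma qPoch_succ (a Q : ℝ) (n : ℕ) : qPoch a Q (n + 1) = qPoch a Q n * (1 - a * Q ^ n) := by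
  simp [qPoch, Finset.prod_range_succ]

lemma qPoch_succ' (a Q : ℝ) (n : ℕ) : qPoch a Q (n + 1) = (1 - a) * qPoch (a * Q) Q n := by
  simp only [qPoch, Finset.prod_range_succ', pow_zero, mul_one]
  rw [mul_comm]
  congr 1
  apply Finset.prod_congr rfl
  intro k _
  ring

lemma qsummable_norm (a : ℝ) {Q : ℝ} (h0 : 0 < Q) (h1 : Q < 1) :
    Summable (fun k : ℕ => ‖-(a * Q ^ k)‖) := by
  have : Summable (fun k : ℕ => |a| * Q ^ k) :=
    (summable_geometric_of_lt_one h0.le h1).mul_left _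
  refine this.congr fun k => ?_
  rw [norm_neg, Real.norm_eq_abs, abs_mul, abs_of_pos (pow_pos h0 k)]

lemma qPoch_tendsto (a : ℝ) {Q : ℝ} (h0 : 0 < Q) (h1 : Q < 1) :
    Tendsto (qPoch a Q) atTop (𝓝 (qPochInf a Q)) := by
  have h := (multipliable_one_add_of_summable (qsummable_norm a h0 h1)).tendsto_prod_tprod_nat
  simp only [← sub_eq_add_neg] at h
  exact h

lemma qPochInf_succ (a : ℝ) {Q : ℝ} (h0 : 0 < Q) (h1 : Q < 1) :
    qPochInf a Q = (1 - a) * qPochInf (a * Q) Q := by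
  have h := (qPoch_tendsto a h0 h1).comp (tendsto_add_atTop_nat 1)
  have h' := (qPoch_tendsto (a * Q) h0 h1).const_mul (1 - a)
  refine tendsto_nhds_unique h (h'.congr fun n => ?_)
  simp [qPoch_succ']

lemma qfac_pos {a Q : ℝ} (ha : a < 1) (h0 : 0 < Q) (h1 : Q < 1) (k : ℕ) : 0 < 1 - a * Q ^ k := by
  have hp := pow_pos h0 k
  have hl : Q ^ k ≤ 1 := pow_le_one₀ h0.le h1.le
  rcases le_or_gt a 0 with h | h
  · nlinarith
  · nlinarith

lemma qPoch_pos {a Q : ℝ} (ha : a < 1) (h0 : 0 < Q) (h1 : Q < 1) (n : ℕ) : 0 < qPoch a Q n :=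
  Finset.prod_pos fun k _ => qfac_pos ha h0 h1 k

lemma qPochInf_pos {a Q : ℝ} (ha : a < 1) (h0 : 0 < Q) (h1 : Q < 1) : 0 < qPochInf a Q := by
  have hn : 0 ≤ qPochInf a Q :=
    ge_of_tendsto' (qPoch_tendsto a h0 h1) fun n => (qPoch_pos ha h0 h1 n).le
  have hne := tprod_one_add_ne_zero_of_summable (f := fun k : ℕ => -(a * Q ^ k))
    (fun k => by have := qfac_pos ha h0 h1 k; simp only [← sub_eq_add_neg]; exact this.ne')
    (qsummable_norm a h0 h1)
  simp only [← sub_eq_add_neg] at hne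
  exact lt_of_le_of_ne hn (Ne.symm hne)

lemma qPoch_antitone {a Q : ℝ} (ha0 : 0 ≤ a) (ha : a < 1) (h0 : 0 < Q) (h1 : Q < 1) :
    Antitone (qPoch a Q) := by
  apply antitone_nat_of_succ_le
  intro n
  rw [qPoch_succ]
  have := qPoch_pos ha h0 h1 n
  have hp := pow_pos h0 n
  have : 1 - a * Q ^ n ≤ 1 := by nlinarith
  nlinarith

lemma qPochInf_le {a Q : ℝ} (ha0 : 0 ≤ a) (ha : a < 1) (h0 : 0 < Q) (h1 : Q < 1) (n : ℕ) :
    qPochInf a Q ≤ qPoch a Q n :=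
  (qPoch_antitone ha0 ha h0 h1).le_of_tendsto (qPoch_tendsto a h0 h1) n

lemma one_le_qPoch {b Q : ℝ} (hb : 0 ≤ b) (h0 : 0 < Q) (n : ℕ) : 1 ≤ qPoch (-b) Q n := by
  induction n with
  | zero => simp [qPoch]
  | succ n ih =>
    rw [qPoch_succ]
    have := mul_nonneg hb (pow_pos h0 n).le
    nlinarith

lemma one_le_qPochInf {b Q : ℝ} (hb : 0 ≤ b) (h0 : 0 < Q) (h1 : Q < 1) : 1 ≤ qPochInf (-b) Q :=
  ge_of_tendsto' (qPoch_tendsto _ h0 h1) fun n => one_le_qPoch hb h0 n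

lemma pser_tendsto {c : ℕ → ℝ} {w Q : ℝ} (hs : Summable fun k => c k * w ^ k)
    (h0 : 0 < Q) (h1 : Q < 1) :
    Tendsto (fun n : ℕ => ∑' k, c k * (w * Q ^ n) ^ k) atTop (𝓝 (c 0)) := by
  have key := tendsto_tsum_of_dominated_convergence (𝓕 := atTop)
    (f := fun (n : ℕ) k => c k * (w * Q ^ n) ^ k) (g := fun k => if k = 0 then c 0 else 0)
    (bound := fun k => ‖c k * w ^ k‖) hs.norm ?_ ?_
  · simpa using key
  · intro k
    rcases Nat.eq_zero_or_pos k with rfl | hk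
    · simp
    · have h : Tendsto (fun n : ℕ => Q ^ n) atTop (𝓝 0) :=
        tendsto_pow_atTop_nhds_zero_of_lt_one h0.le h1
      have := ((h.const_mul w).pow k).const_mul (c k)
      simpa [hk.ne'] using this
  · refine Eventually.of_forall fun n k => ?_
    rw [mul_pow, ← mul_assoc, norm_mul]
    refine mul_le_of_le_one_right (norm_nonneg _) ?_
    rw [Real.norm_eq_abs, abs_of_nonneg (by positivity)]
    exact pow_le_one₀ (by positivity) (pow_le_one₀ h0.le h1.le)

lemma pser_summable_mul {c : ℕ → ℝ} {w Q : ℝ} (hs : Summable fun k => c k * w ^ k)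
    (h0 : 0 < Q) (h1 : Q < 1) : Summable fun k => c k * (w * Q) ^ k := by
  refine Summable.of_norm_bounded hs.norm fun k => ?_
  rw [mul_pow, ← mul_assoc, norm_mul]
  refine mul_le_of_le_one_right (norm_nonneg _) ?_
  rw [Real.norm_eq_abs, abs_of_nonneg (by positivity)]
  exact pow_le_one₀ (by positivity) h1.le

lemma pser_fun_eq {c : ℕ → ℝ} {w Q a b : ℝ} (hs : Summable fun k => c k * w ^ k)
    (h0 : 0 < Q) (h1 : Q < 1)
    (hc : ∀ k, c (k + 1) * (1 - Q ^ (k + 1)) = (a + b * Q ^ k) * c k) :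
    (∑' k, c k * w ^ k) - (∑' k, c k * (w * Q) ^ k) =
      a * w * (∑' k, c k * w ^ k) + b * w * (∑' k, c k * (w * Q) ^ k) := by
  have hs' := pser_summable_mul hs h0 h1
  rw [← hs.tsum_sub hs', (hs.sub hs').tsum_eq_zero_add, ← tsum_mul_left, ← tsum_mul_left,
    ← (hs.mul_left _).tsum_add (hs'.mul_left _)]
  simp only [pow_zero, sub_self, zero_add]
  apply tsum_congr
  intro k
  have := hc k
  calc c (k + 1) * w ^ (k + 1) - c (k + 1) * (w * Q) ^ (k + 1)
      = (c (k + 1) * (1 - Q ^ (k + 1))) * w ^ (k + 1) := by rw [mul_pow]; ring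
    _ = _ := by rw [this, mul_pow]; ring

/-- q-binomial theorem. -/
lemma qbinomial {A z Q : ℝ} (h0 : 0 < Q) (h1 : Q < 1) (hz : z < 1)
    (hs : Summable fun k => qPoch A Q k / qPoch Q Q k * z ^ k) :
    ∑' k, qPoch A Q k / qPoch Q Q k * z ^ k = qPochInf (A * z) Q / qPochInf z Q := by
  set c : ℕ → ℝ := fun k => qPoch A Q k / qPoch Q Q k with hcdef
  have hc : ∀ k, c (k + 1) * (1 - Q ^ (k + 1)) = (1 + (-A) * Q ^ k) * c k := by
    intro k
    simp only [hcdef, qPoch_succ]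
    have h := (qPoch_pos h1 h0 h1 k).ne'
    have h' := (qfac_pos h1 h0 h1 k).ne'
    rw [pow_succ']
    generalize 1 - Q * Q ^ k = X at h' ⊢
    field_simp
    ring
  have hsn : ∀ n : ℕ, Summable fun k => c k * (z * Q ^ n) ^ k := by
    intro n
    induction n with
    | zero => simpa using hs
    | succ n ih => simpa [pow_succ, mul_assoc] using pser_summable_mul ih h0 h1
  have hit : ∀ n : ℕ, qPoch z Q n * ∑' k, c k * z ^ k =
      qPoch (A * z) Q n * ∑' k, c k * (z * Q ^ n) ^ k := by
    intro n
    induction n with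
    | zero => simp [qPoch]
    | succ n ih =>
      have h := pser_fun_eq (hsn n) h0 h1 hc
      rw [mul_assoc z, ← pow_succ] at h
      rw [qPoch_succ, qPoch_succ]
      calc _ = (1 - z * Q ^ n) * (qPoch z Q n * ∑' k, c k * z ^ k) := by ring
        _ = _ := by rw [ih]; linear_combination (qPoch (A * z) Q n) * h
  have l1 := (qPoch_tendsto z h0 h1).mul_const (∑' k, c k * z ^ k)
  have l2 := (qPoch_tendsto (A * z) h0 h1).mul (pser_tendsto hs h0 h1)
  have := tendsto_nhds_unique l1 (l2.congr fun n => (hit n).symm)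
  rw [eq_div_iff (qPochInf_pos hz h0 h1).ne', mul_comm, this]
  simp [hcdef, qPoch]

lemma gauss_summable {q : ℝ} (h0 : 0 < q) (h1 : q < 1) (u : ℝ) :
    Summable fun k : ℕ => q ^ (k ^ 2) * u ^ k := by
  rcases eq_or_ne u 0 with rfl | hu
  · refine summable_of_ne_finset_zero (s := {0}) fun k hk => ?_
    simp at hk
    simp [hk]
  · refine summable_of_ratio_test_tendsto_lt_one (l := 0) one_pos
      (Eventually.of_forall fun n => by positivity) ?_
    have h : Tendsto (fun n : ℕ => (q ^ n) ) atTop (𝓝 0) :=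
        tendsto_pow_atTop_nhds_zero_of_lt_one h0.le h1
    have h2 := ((h.mul h).mul_const (q * |u|))
    simp only [zero_mul] at h2
    refine h2.congr fun n => ?_
    rw [norm_mul, norm_mul, norm_pow, norm_pow, norm_pow, norm_pow, Real.norm_eq_abs,
      Real.norm_eq_abs, abs_of_pos h0]
    have : |u| ≠ 0 := by positivity
    field_simp
    ring

/-- Euler: product of the two q-exponentials is one. -/
lemma euler_mul {q u : ℝ} (h0 : 0 < q) (h1 : q < 1)
    (hs : Summable fun k : ℕ => (-q) ^ k / qPoch (q ^ 2) (q ^ 2) k * u ^ k)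
    (hs2 : Summable fun k : ℕ => q ^ (k ^ 2) / qPoch (q ^ 2) (q ^ 2) k * u ^ k) :
    (∑' k : ℕ, (-q) ^ k / qPoch (q ^ 2) (q ^ 2) k * u ^ k) *
      (∑' k : ℕ, q ^ (k ^ 2) / qPoch (q ^ 2) (q ^ 2) k * u ^ k) = 1 := by
  have g0 : 0 < q ^ 2 := by positivity
  have g1 : q ^ 2 < 1 := by nlinarith
  set c : ℕ → ℝ := fun k => (-q) ^ k / qPoch (q ^ 2) (q ^ 2) k with hcdef
  set d : ℕ → ℝ := fun k => q ^ (k ^ 2) / qPoch (q ^ 2) (q ^ 2) k with hddef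
  have hc : ∀ k, c (k + 1) * (1 - (q ^ 2) ^ (k + 1)) = (-q + 0 * (q ^ 2) ^ k) * c k := by
    intro k
    simp only [hcdef, qPoch_succ]
    have h := (qPoch_pos g1 g0 g1 k).ne'
    have h' := (qfac_pos g1 g0 g1 k).ne'
    rw [pow_succ' (q ^ 2)]
    field_simp
    ring
  have hd : ∀ k, d (k + 1) * (1 - (q ^ 2) ^ (k + 1)) = (0 + q * (q ^ 2) ^ k) * d k := by
    intro k
    simp only [hddef, qPoch_succ]
    have h := (qPoch_pos g1 g0 g1 k).ne'
    have h' := (qfac_pos g1 g0 g1 k).ne'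
    rw [pow_succ' (q ^ 2)]
    rw [show (k + 1) ^ 2 = k ^ 2 + 1 + 2 * k by ring, pow_add, pow_add, pow_mul]
    field_simp
    ring
  have hsn : ∀ n : ℕ, Summable fun k => c k * (u * (q ^ 2) ^ n) ^ k := by
    intro n
    induction n with
    | zero => simpa using hs
    | succ n ih =>
      have := pser_summable_mul ih g0 g1
      rwa [mul_assoc u, ← pow_succ] at this
  have hsn2 : ∀ n : ℕ, Summable fun k => d k * (u * (q ^ 2) ^ n) ^ k := by
    intro n
    induction n with
    | zero => simpa using hs2
    | succ n ih =>
      have := pser_summable_mul ih g0 g1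
      rwa [mul_assoc u, ← pow_succ] at this
  have hit : ∀ n : ℕ, (∑' k, c k * u ^ k) * (∑' k, d k * u ^ k) =
      (∑' k, c k * (u * (q ^ 2) ^ n) ^ k) * (∑' k, d k * (u * (q ^ 2) ^ n) ^ k) := by
    intro n
    induction n with
    | zero => simp
    | succ n ih =>
      have h := pser_fun_eq (hsn n) g0 g1 hc
      have h2 := pser_fun_eq (hsn2 n) g0 g1 hd
      rw [mul_assoc u, ← pow_succ] at h h2
      rw [ih]
      linear_combination (∑' k, c k * (u * (q ^ 2) ^ n) ^ k) * h2 +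
        (∑' k, d k * (u * (q ^ 2) ^ (n + 1)) ^ k) * h
  have l2 := (pser_tendsto hs g0 g1).mul (pser_tendsto hs2 g0 g1)
  have := tendsto_nhds_unique tendsto_const_nhds (l2.congr fun n => (hit n).symm)
  rw [this]
  simp [hcdef, hddef, qPoch]

/-- the weight on the lattice. -/
def Wt (b Q : ℝ) (k : ℤ) : ℝ := (qPochInf (-(b * Q ^ k)) Q)⁻¹

section bil

lemma Wt_pos (b Q : ℝ) (hb : 0 < b) (h0 : 0 < Q) (h1 : Q < 1) (k : ℤ) : 0 < Wt b Q k := by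
  have : 0 ≤ b * Q ^ k := by positivity
  have := one_le_qPochInf this h0 h1
  exact inv_pos.2 (by linarith)

lemma Wt_le_one (b Q : ℝ) (hb : 0 < b) (h0 : 0 < Q) (h1 : Q < 1) (k : ℤ) : Wt b Q k ≤ 1 := by
  have : 0 ≤ b * Q ^ k := by positivity
  exact inv_le_one_of_one_le₀ (one_le_qPochInf this h0 h1)

lemma Wt_succ (b Q : ℝ) (hb : 0 < b) (h0 : 0 < Q) (h1 : Q < 1) (k : ℤ) :
    Wt b Q (k + 1) = (1 + b * Q ^ k) * Wt b Q k := by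
  have hx : 0 < b * Q ^ k := by positivity
  have h := qPochInf_succ (-(b * Q ^ k)) h0 h1
  have e : -(b * Q ^ k) * Q = -(b * Q ^ (k + 1)) := by rw [zpow_add_one₀ h0.ne']; ring
  rw [e] at h
  have hp := one_le_qPochInf (b := b * Q ^ (k + 1)) (by positivity) h0 h1
  unfold Wt
  rw [h]
  have : 1 - -(b * Q ^ k) ≠ 0 := by linarith
  rw [sub_neg_eq_add] at *
  field_simp

lemma bil_summable (b z Q : ℝ) (hb : 0 < b) (h0 : 0 < Q) (h1 : Q < 1) (hz0 : 0 < z) (hz1 : z < 1) :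
    Summable fun k : ℤ => z ^ k * Wt b Q k := by
  apply Summable.of_nat_of_neg
  · refine Summable.of_nonneg_of_le (fun n => ?_) (fun n => ?_)
      (summable_geometric_of_lt_one hz0.le hz1)
    · exact mul_nonneg (by positivity) (Wt_pos b Q hb h0 h1 _).le
    · rw [zpow_natCast]
      exact mul_le_of_le_one_right (by positivity) (Wt_le_one b Q hb h0 h1 _)
  · have hpos : ∀ n : ℕ, 0 < z ^ (-(n : ℤ)) * Wt b Q (-(n : ℤ)) := fun n =>
      mul_pos (by positivity) (Wt_pos b Q hb h0 h1 _)
    refine summable_of_ratio_test_tendsto_lt_one (l := 0) one_pos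
      (Eventually.of_forall fun n => (hpos n).ne') ?_
    have h : Tendsto (fun n : ℕ => Q ^ (n + 1)) atTop (𝓝 0) :=
      (tendsto_pow_atTop_nhds_zero_of_lt_one h0.le h1).comp (tendsto_add_atTop_nat 1)
    have h2 : Tendsto (fun n : ℕ => z⁻¹ * (Q ^ (n + 1) / (Q ^ (n + 1) + b))) atTop
        (𝓝 (z⁻¹ * (0 / (0 + b)))) :=
      (h.div (h.add_const b) (by simpa using hb.ne')).const_mul _
    simp only [zero_div, mul_zero] at h2
    refine h2.congr fun n => ?_
    rw [Real.norm_of_nonneg (hpos _).le, Real.norm_of_nonneg (hpos _).le]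
    have hW := Wt_succ b Q hb h0 h1 (-((n + 1 : ℕ) : ℤ))
    rw [show (-((n + 1 : ℕ) : ℤ)) + 1 = -(n : ℤ) by push_cast; ring] at hW
    rw [hW]
    have hWp := (Wt_pos b Q hb h0 h1 (-((n + 1 : ℕ) : ℤ))).ne'
    generalize Wt b Q (-((n + 1 : ℕ) : ℤ)) = w at *
    rw [zpow_neg, zpow_neg, zpow_neg, zpow_natCast, zpow_natCast, zpow_natCast]
    have : Q ^ (n + 1) + b ≠ 0 := by positivity
    have : 1 + b * (Q ^ (n + 1))⁻¹ ≠ 0 := by positivity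
    have e : 1 + b * (Q ^ (n + 1))⁻¹ = (Q ^ (n + 1) + b) / Q ^ (n + 1) := by
      field_simp
    rw [e, pow_succ z]
    field_simp

lemma bil_rec (b z Q : ℝ) (hb : 0 < b) (h0 : 0 < Q) (h1 : Q < 1) (hz0 : 0 < z) (hz1 : z < 1) :
    ∑' k : ℤ, (z * Q) ^ k * Wt b Q k = (1 - z) / (b * z) * ∑' k : ℤ, z ^ k * Wt b Q k := by
  have hs := bil_summable b z Q hb h0 h1 hz0 hz1
  have hs' := bil_summable b (z * Q) Q hb h0 h1 (by positivity) (by nlinarith)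
  have h := (Equiv.addRight (1 : ℤ)).tsum_eq (fun k : ℤ => z ^ k * Wt b Q k)
  simp only [Equiv.coe_addRight] at h
  have h2 : (fun k : ℤ => z ^ (k + 1) * Wt b Q (k + 1)) =
      fun k : ℤ => z * (z ^ k * Wt b Q k) + (b * z) * ((z * Q) ^ k * Wt b Q k) := by
    funext k
    rw [Wt_succ b Q hb h0 h1, zpow_add_one₀ hz0.ne', mul_zpow]
    ring
  rw [h2, (hs.mul_left z).tsum_add (hs'.mul_left (b * z)), tsum_mul_left, tsum_mul_left] at h
  field_simp
  linarith

lemma Wt_shift (b Q : ℝ) (hb : 0 < b) (h0 : 0 < Q) (h1 : Q < 1) (N : ℤ) (j : ℕ) :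
    Wt b Q (N + j) = qPoch (-(b * Q ^ N)) Q j * Wt b Q N := by
  induction j with
  | zero => simp [qPoch]
  | succ j ih =>
    push_cast
    rw [← add_assoc, Wt_succ b Q hb h0 h1, ih, qPoch_succ, zpow_add₀ h0.ne', zpow_natCast]
    ring

lemma bil_fin (b z Q : ℝ) (hb : 0 < b) (h0 : 0 < Q) (h1 : Q < 1) (hz0 : 0 < z) (N : ℕ) :
    z ^ (-(N : ℤ)) * Wt b Q (-(N : ℤ)) * qPochInf (-(b * Q ^ (-(N : ℤ))) * z) Q =
      qPoch (-(Q / (b * z))) Q N / qPoch (-(Q / b)) Q N * (qPochInf (-(b * z)) Q / qPochInf (-b) Q)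
      := by
  induction N with
  | zero => simp [qPoch, Wt]; ring
  | succ N ih =>
    have hW := Wt_succ b Q hb h0 h1 (-((N + 1 : ℕ) : ℤ))
    rw [show (-((N + 1 : ℕ) : ℤ)) + 1 = -(N : ℤ) by push_cast; ring] at hW
    have hP := qPochInf_succ (-(b * Q ^ (-((N + 1 : ℕ) : ℤ))) * z) h0 h1
    have e : -(b * Q ^ (-((N + 1 : ℕ) : ℤ))) * z * Q = -(b * Q ^ (-(N : ℤ))) * z := by
      rw [show -(N : ℤ) = (-((N + 1 : ℕ) : ℤ)) + 1 by push_cast; ring, zpow_add_one₀ h0.ne']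
      ring
    rw [e] at hP
    rw [hW] at ih
    rw [hP, qPoch_succ, qPoch_succ]
    have p1 := one_le_qPoch (b := Q / (b * z)) (by positivity) h0 N
    have p2 := one_le_qPoch (b := Q / b) (by positivity) h0 N
    have hq : Q ^ (-((N + 1 : ℕ) : ℤ)) = (Q * Q ^ N)⁻¹ := by
      rw [zpow_neg, zpow_natCast, pow_succ']
    have hz : z ^ (-((N + 1 : ℕ) : ℤ)) = z⁻¹ * z ^ (-(N : ℤ)) := by
      rw [zpow_neg, zpow_neg, zpow_natCast, zpow_natCast, pow_succ', mul_inv]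
    rw [hq] at ih ⊢
    rw [hz]
    set X := Q * Q ^ N with hX
    have hXp : 0 < X := by positivity
    generalize z ^ (-(N : ℤ)) = zz at *
    generalize Wt b Q (-((N + 1 : ℕ) : ℤ)) = w at *
    generalize qPochInf (-(b * Q ^ (-(N : ℤ))) * z) Q = R at *
    generalize qPochInf (-(b * z)) Q / qPochInf (-b) Q = T at *
    have e1 : 1 - -(Q / (b * z)) * Q ^ N = (b * z + X) / (b * z) := by
      rw [hX]; field_simp; ring
    have e2 : 1 - -(Q / b) * Q ^ N = (b + X) / b := by
      rw [hX]; field_simp; ring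
    have e3 : 1 - -(b * X⁻¹) * z = (b * z + X) / X := by
      field_simp; ring
    have e4 : 1 + b * X⁻¹ = (b + X) / X := by
      field_simp; ring
    rw [e4] at ih
    rw [e1, e2, e3]
    calc z⁻¹ * zz * w * ((b * z + X) / X * R)
        = (zz * ((b + X) / X * w) * R) * ((b * z + X) / (z * (b + X))) := by field_simp
      _ = _ := by rw [ih]; field_simp

lemma bil_val (b z Q : ℝ) (hb : 0 < b) (h0 : 0 < Q) (h1 : Q < 1) (hz0 : 0 < z) (hz1 : z < 1) :
    ∑' k : ℤ, z ^ k * Wt b Q k = qPochInf Q Q * (qPochInf (-(Q / (b * z))) Q /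
      qPochInf (-(Q / b)) Q * (qPochInf (-(b * z)) Q / qPochInf (-b) Q) / qPochInf z Q) := by
  have hs := bil_summable b z Q hb h0 h1 hz0 hz1
  have hQp := qPochInf_pos h1 h0 h1
  have hle := qPochInf_le h0.le h1 h0 h1
  have hpos : ∀ k : ℤ, 0 < z ^ k * Wt b Q k := fun k =>
    mul_pos (by positivity) (Wt_pos b Q hb h0 h1 _)
  have key := tendsto_tsum_of_dominated_convergence (𝓕 := atTop)
    (f := fun (N : ℕ) (k : ℤ) =>
      if 0 ≤ k + N then z ^ k * Wt b Q k / qPoch Q Q (k + N).toNat else 0)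
    (g := fun k => z ^ k * Wt b Q k / qPochInf Q Q)
    (bound := fun k => z ^ k * Wt b Q k / qPochInf Q Q) (hs.div_const _) ?_ ?_
  · have hN : ∀ N : ℕ, (∑' k : ℤ,
        if 0 ≤ k + N then z ^ k * Wt b Q k / qPoch Q Q (k + N).toNat else 0) =
        qPoch (-(Q / (b * z))) Q N / qPoch (-(Q / b)) Q N *
          (qPochInf (-(b * z)) Q / qPochInf (-b) Q) / qPochInf z Q := by
      intro N
      have hinj : Function.Injective (fun j : ℕ => -(N : ℤ) + j) := by
        intro a b h; simpa using h
      rw [← hinj.tsum_eq (f := fun k : ℤ =>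
        if 0 ≤ k + N then z ^ k * Wt b Q k / qPoch Q Q (k + N).toNat else 0)]
      · have e : ∀ j : ℕ, (if 0 ≤ -(N : ℤ) + j + N then z ^ (-(N : ℤ) + j) * Wt b Q (-(N : ℤ) + j) /
            qPoch Q Q (-(N : ℤ) + j + N).toNat else 0) = (z ^ (-(N : ℤ)) * Wt b Q (-(N : ℤ))) *
            (qPoch (-(b * Q ^ (-(N : ℤ)))) Q j / qPoch Q Q j * z ^ j) := by
          intro j
          have : -(N : ℤ) + j + N = j := by ring
          rw [this, if_pos (by positivity), Wt_shift b Q hb h0 h1, zpow_add₀ hz0.ne']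
          simp only [Int.toNat_natCast, zpow_natCast]
          ring
        simp only [e]
        rw [tsum_mul_left, qbinomial h0 h1 hz1, ← bil_fin b z Q hb h0 h1 hz0]
        · ring
        · have h3 := ((hs.div_const (qPochInf Q Q)).comp_injective hinj).mul_left
            (z ^ (-(N : ℤ)) * Wt b Q (-(N : ℤ)))⁻¹
          refine Summable.of_nonneg_of_le (fun j => ?_) (fun j => ?_) h3
          · have := qPoch_pos h1 h0 h1 j
            have := one_le_qPoch (b := b * Q ^ (-(N : ℤ))) (by positivity) h0 j
            positivity
          · rw [le_inv_mul_iff₀ (hpos _), ← e]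
            have : -(N : ℤ) + j + N = j := by ring
            rw [this, if_pos (by positivity)]
            simp only [Function.comp]
            exact div_le_div_of_nonneg_left (hpos _).le hQp (hle _)
      · intro k hk
        simp only [Function.mem_support, ne_eq, ite_eq_right_iff, not_forall] at hk
        obtain ⟨h, -⟩ := hk
        exact ⟨(k + N).toNat, by simp only; omega⟩
    simp only [hN] at key
    have l := (((qPoch_tendsto (-(Q / (b * z))) h0 h1).div (qPoch_tendsto (-(Q / b)) h0 h1)
      (by have := one_le_qPochInf (b := Q / b) (by positivity) h0 h1; linarith)).mul_const
      (qPochInf (-(b * z)) Q / qPochInf (-b) Q)).div_const (qPochInf z Q)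
    have := tendsto_nhds_unique key l
    rw [tsum_div_const, div_eq_iff hQp.ne'] at this
    rw [this]; ring
  · intro k
    have h2 : Tendsto (fun N : ℕ => (k + N).toNat) atTop atTop := by
      rw [tendsto_atTop]
      intro m
      filter_upwards [eventually_ge_atTop (m + k.natAbs)] with N hN
      omega
    have h3 := ((tendsto_const_nhds (x := z ^ k * Wt b Q k)).div
      ((qPoch_tendsto Q h0 h1).comp h2) hQp.ne')
    refine h3.congr' ?_
    filter_upwards [eventually_ge_atTop k.natAbs] with N hN
    rw [if_pos (by omega)]
    rfl
  · refine Eventually.of_forall fun N k => ?_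
    split_ifs
    · rw [Real.norm_of_nonneg (div_nonneg (hpos k).le (qPoch_pos h1 h0 h1 _).le)]
      exact div_le_div_of_nonneg_left (hpos k).le hQp (hle _)
    · rw [norm_zero]
      exact div_nonneg (hpos k).le hQp.le

end bil

/-- Gaussian binomial coefficients through the Pascal recursion. -/
def gb (Q : ℝ) : ℕ → ℕ → ℝ
  | _, 0 => 1
  | 0, _ + 1 => 0
  | i + 1, n + 1 => gb Q i (n + 1) + Q ^ (i - n) * gb Q i n

lemma gb_zero_right (Q : ℝ) (i : ℕ) : gb Q i 0 = 1 := by cases i <;> rfl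

lemma gb_succ (Q : ℝ) (i n : ℕ) :
    gb Q (i + 1) (n + 1) = gb Q i (n + 1) + Q ^ (i - n) * gb Q i n := rfl

lemma gb_of_lt (Q : ℝ) : ∀ i n : ℕ, i < n → gb Q i n = 0 := by
  intro i
  induction i with
  | zero => intro n hn; obtain ⟨m, rfl⟩ := Nat.exists_eq_succ_of_ne_zero hn.ne'; rfl
  | succ i ih =>
    intro n hn
    obtain ⟨m, rfl⟩ := Nat.exists_eq_succ_of_ne_zero (by omega : n ≠ 0)
    rw [Nat.succ_eq_add_one, gb_succ, ih _ (by omega), ih _ (by omega)]; ring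

lemma gb_eq (Q : ℝ) : ∀ i a n : ℕ, i = a + n → gb Q i n * (qPoch Q Q n * qPoch Q Q a) = qPoch Q Q i := by
  intro i
  induction i with
  | zero =>
    intro a n h
    obtain ⟨rfl, rfl⟩ : a = 0 ∧ n = 0 := by omega
    simp [gb, qPoch]
  | succ i ih =>
    intro a n h
    rcases n with _ | n
    · rw [gb_zero_right]
      obtain rfl : a = i + 1 := by omega
      simp [qPoch]
    · rw [gb_succ]
      have e2 := ih a n (by omega)
      rcases a with _ | a
      · rw [gb_of_lt Q i (n + 1) (by omega)]
        obtain rfl : i = n := by omega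
        rw [qPoch_succ Q Q i]
        simp only [Nat.sub_self, pow_zero]
        linear_combination (1 - Q * Q ^ i) * e2
      · have e1 := ih a (n + 1) (by omega)
        obtain rfl : i = a + 1 + n := by omega
        rw [Nat.add_sub_cancel, qPoch_succ Q Q (a + 1 + n)]
        have s1 := qPoch_succ Q Q a
        have s2 := qPoch_succ Q Q n
        rw [s1] at e2 ⊢
        rw [s2] at e1 ⊢
        have : Q ^ (a + 1 + n) = Q ^ a * Q * Q ^ n := by ring
        rw [this]
        have : Q ^ (a + 1) = Q ^ a * Q := by ring
        rw [this]
        linear_combination (1 - Q * Q ^ a) * e1 + Q ^ a * Q * (1 - Q * Q ^ n) * e2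

/-- falling q-factorial. -/
def qfall (Q : ℝ) (j n : ℕ) : ℝ := ∏ k ∈ Finset.range n, (1 - Q ^ (j - k))

lemma qfall_of_lt (Q : ℝ) {j n : ℕ} (h : j < n) : qfall Q j n = 0 :=
  Finset.prod_eq_zero (Finset.mem_range.2 h) (by simp)

lemma qfall_succ (Q : ℝ) (j n : ℕ) : qfall Q j (n + 1) = qfall Q j n * (1 - Q ^ (j - n)) := by
  simp [qfall, Finset.prod_range_succ]

lemma qfall_eq (Q : ℝ) (n : ℕ) : ∀ b : ℕ, qfall Q (b + n) n * qPoch Q Q b = qPoch Q Q (b + n) := by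
  induction n with
  | zero => intro b; simp [qfall]
  | succ n ih =>
    intro b
    have := ih (b + 1)
    rw [qPoch_succ Q Q b] at this
    rw [qfall_succ, show b + (n + 1) = b + 1 + n by ring, ← this, Nat.add_sub_cancel]
    ring

lemma vand0 (Q : ℝ) (j i : ℕ) : ∀ z : ℝ, qPoch (z * Q ^ j) Q i =
    ∑ n ∈ Finset.range (i + 1),
      Q ^ ((i - n) * (j - n)) * gb Q i n * qfall Q j n * qPoch (z * Q ^ n) Q (i - n) := by
  induction i with
  | zero => intro z; simp [qPoch, gb, qfall]
  | succ i ih =>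
    intro z
    rw [qPoch_succ', show z * Q ^ j * Q = (z * Q) * Q ^ j by ring, ih (z * Q)]
    set X : ℕ → ℝ := fun n =>
      Q ^ ((i + 1 - n) * (j - n)) * gb Q i n * qfall Q j n * qPoch (z * Q ^ n) Q (i + 1 - n) with hX
    set Y : ℕ → ℝ := fun n =>
      Q ^ ((i - n) * (j - n)) * gb Q i n * qfall Q j (n + 1) * qPoch (z * Q ^ (n + 1)) Q (i - n)
      with hY
    have hXi : X (i + 1) = 0 := by
      simp only [hX, gb_of_lt Q i (i + 1) (by omega)]; ring
    have hA : ∑ n ∈ Finset.range (i + 1 + 1),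
        Q ^ ((i + 1 - n) * (j - n)) * gb Q (i + 1) n * qfall Q j n *
          qPoch (z * Q ^ n) Q (i + 1 - n) = X 0 + ∑ n ∈ Finset.range (i + 1), (X (n + 1) + Y n) := by
      rw [Finset.sum_range_succ', add_comm]
      congr 1
      · simp [hX, gb_zero_right]
      · apply Finset.sum_congr rfl
        intro n hn
        have hn' : n < i + 1 := Finset.mem_range.1 hn
        simp only [hX, hY, gb_succ]
        rcases lt_or_ge n j with hj | hj
        · have e1 : i + 1 - (n + 1) = i - n := by omega
          obtain ⟨c, rfl⟩ : ∃ c, j = n + 1 + c := ⟨j - n - 1, by omega⟩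
          rw [e1, show n + 1 + c - (n + 1) = c by omega, show n + 1 + c - n = c + 1 by omega,
            Nat.mul_succ, pow_add]
          ring
        · rw [qfall_of_lt Q (by omega : j < n + 1)]
          ring
    rw [hA, Finset.sum_add_distrib, ← add_assoc, add_comm (X 0), ← Finset.sum_range_succ' X,
      Finset.sum_range_succ X, hXi, add_zero, ← Finset.sum_add_distrib, Finset.mul_sum]
    apply Finset.sum_congr rfl
    intro n hn
    have hn' : n < i + 1 := Finset.mem_range.1 hn
    simp only [hX, hY]
    rcases le_or_gt n j with hj | hj
    · obtain ⟨c, rfl⟩ : ∃ c, j = n + c := ⟨j - n, by omega⟩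
      obtain ⟨a, rfl⟩ : ∃ a, i = n + a := ⟨i - n, by omega⟩
      rw [qfall_succ, show n + c - n = c by omega, show n + a + 1 - n = a + 1 by omega,
        show n + a - n = a by omega, qPoch_succ', show z * Q ^ n * Q = z * Q ^ (n + 1) by ring,
        show z * Q * Q ^ n = z * Q ^ (n + 1) by ring, Nat.succ_mul, pow_add, pow_add]
      ring
    · rw [qfall_of_lt Q hj, qfall_of_lt Q (by omega : j < n + 1)]
      ring

lemma qPoch_add (a Q : ℝ) (m n : ℕ) : qPoch a Q (m + n) = qPoch a Q m * qPoch (a * Q ^ m) Q n := by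
  simp only [qPoch, Finset.prod_range_add]
  congr 1
  apply Finset.prod_congr rfl
  intro k _
  ring

lemma vand {Q z : ℝ} (h0 : 0 < Q) (h1 : Q < 1) (hz1 : z < 1) (i j : ℕ) :
    qPoch z Q (i + j) / (qPoch Q Q i * qPoch z Q i * (qPoch Q Q j * qPoch z Q j)) =
    ∑ n ∈ Finset.range (i + 1), if n ≤ i ∧ n ≤ j then
      Q ^ ((i - n) * (j - n)) / (qPoch Q Q (i - n) * qPoch Q Q (j - n) *
        (qPoch Q Q n * qPoch z Q n)) else 0 := by
  have hp := fun n => (qPoch_pos h1 h0 h1 n).ne'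
  have hp' := fun n => (qPoch_pos hz1 h0 h1 n).ne'
  rw [add_comm i j, qPoch_add, vand0, Finset.mul_sum, Finset.sum_div]
  apply Finset.sum_congr rfl
  intro n hn
  have hn' : n < i + 1 := Finset.mem_range.1 hn
  rcases le_or_gt n j with hj | hj
  · rw [if_pos ⟨by omega, hj⟩]
    obtain ⟨c, rfl⟩ : ∃ c, j = c + n := ⟨j - n, by omega⟩
    obtain ⟨a, rfl⟩ : ∃ a, i = a + n := ⟨i - n, by omega⟩
    simp only [Nat.add_sub_cancel]
    have e1 := gb_eq Q (a + n) a n rfl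
    have e2 := qfall_eq Q n c
    have e3 := qPoch_add z Q n a
    rw [add_comm n a] at e3
    have := hp a; have := hp c; have := hp n; have := hp (a + n); have := hp (c + n)
    have := hp' n; have := hp' (a + n); have := hp' (c + n)
    rw [div_eq_div_iff (by positivity) (by positivity), ← e1, ← e2, e3]
    ring
  · rw [if_neg (by omega), qfall_of_lt Q hj]
    ring

lemma star_hasSum {q z u v : ℝ} (h0 : 0 < q) (h1 : q < 1) (hz1 : z < 1)
    (hu : 0 ≤ u) (hv : 0 ≤ v) {A B C : ℝ}
    (hA : HasSum (fun k : ℕ => q ^ (k ^ 2) / qPoch (q ^ 2) (q ^ 2) k * u ^ k) A)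
    (hB : HasSum (fun k : ℕ => q ^ (k ^ 2) / qPoch (q ^ 2) (q ^ 2) k * v ^ k) B)
    (hC : HasSum (fun k : ℕ => (u * v) ^ k / (qPoch (q ^ 2) (q ^ 2) k * qPoch z (q ^ 2) k)) C) :
    HasSum (fun p : ℕ × ℕ => q ^ (2 * p.1 ^ 2 + 2 * p.2 ^ 2) / q ^ ((p.1 + p.2) ^ 2) *
      (qPoch z (q ^ 2) (p.1 + p.2) / (qPoch (q ^ 2) (q ^ 2) p.1 * qPoch z (q ^ 2) p.1 *
        (qPoch (q ^ 2) (q ^ 2) p.2 * qPoch z (q ^ 2) p.2))) * (u ^ p.1 * v ^ p.2))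
      (A * B * C) := by
  have g0 : 0 < q ^ 2 := by positivity
  have g1 : q ^ 2 < 1 := by nlinarith
  have hp := fun n => (qPoch_pos g1 g0 g1 n)
  have hp' := fun n => (qPoch_pos hz1 g0 g1 n)
  have nA : ∀ w : ℝ, 0 ≤ w → 0 ≤ fun k : ℕ => q ^ (k ^ 2) / qPoch (q ^ 2) (q ^ 2) k * w ^ k := by
    intro w hw k
    have := hp k
    simp only [Pi.zero_apply]
    positivity
  have nC : 0 ≤ fun k : ℕ => (u * v) ^ k / (qPoch (q ^ 2) (q ^ 2) k * qPoch z (q ^ 2) k) := by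
    intro k
    have := hp k
    have := hp' k
    simp only [Pi.zero_apply]
    positivity
  have sAB := hA.summable.mul_of_nonneg hB.summable (nA u hu) (nA v hv)
  have hAB := hA.mul hB sAB
  have hABC := hAB.mul hC (hAB.summable.mul_of_nonneg hC.summable
    (fun p => mul_nonneg (nA u hu p.1) (nA v hv p.2)) nC)
  set g : (ℕ × ℕ) × ℕ → ℝ := fun x => if x.2 ≤ x.1.1 ∧ x.2 ≤ x.1.2 then
      (q ^ ((x.1.1 - x.2) ^ 2) / qPoch (q ^ 2) (q ^ 2) (x.1.1 - x.2) * u ^ (x.1.1 - x.2)) *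
      (q ^ ((x.1.2 - x.2) ^ 2) / qPoch (q ^ 2) (q ^ 2) (x.1.2 - x.2) * v ^ (x.1.2 - x.2)) *
      ((u * v) ^ x.2 / (qPoch (q ^ 2) (q ^ 2) x.2 * qPoch z (q ^ 2) x.2)) else 0 with hg
  set m : (ℕ × ℕ) × ℕ → (ℕ × ℕ) × ℕ := fun x => ((x.1.1 + x.2, x.1.2 + x.2), x.2) with hm
  have hinj : Function.Injective m := by
    rintro ⟨⟨a, b⟩, n⟩ ⟨⟨a', b'⟩, n'⟩ h
    simp only [hm, Prod.mk.injEq] at h ⊢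
    omega
  have hgm : HasSum g (A * B * C) := by
    rw [← hinj.hasSum_iff]
    · refine hABC.congr_fun ?_
      intro x
      simp [hg, hm]
    · rintro ⟨⟨i, j⟩, n⟩ hx
      simp only [hg]
      rw [if_neg]
      rintro ⟨hi, hj⟩
      apply hx
      refine ⟨((i - n, j - n), n), ?_⟩
      have hi' : n ≤ i := hi
      have hj' : n ≤ j := hj
      simp only [hm]
      rw [Nat.sub_add_cancel hi', Nat.sub_add_cancel hj']
  refine hgm.prod_fiberwise ?_
  rintro ⟨i, j⟩
  have hfin := hasSum_sum_of_ne_finset_zero (f := fun n => g ((i, j), n))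
    (s := Finset.range (i + 1)) (L := .unconditional ℕ) (by
      intro n hn
      simp only [Finset.mem_range, not_lt] at hn
      simp only [hg]
      rw [if_neg (by omega)])
  convert hfin using 1
  simp only
  rw [vand g0 g1 hz1, Finset.mul_sum, Finset.sum_mul]
  apply Finset.sum_congr rfl
  intro n hn
  have hn' : n < i + 1 := Finset.mem_range.1 hn
  simp only [hg]
  rcases le_or_gt n j with hj | hj
  · rw [if_pos ⟨by omega, hj⟩, if_pos ⟨by omega, hj⟩]
    obtain ⟨b, rfl⟩ : ∃ c, j = c + n := ⟨j - n, by omega⟩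
    obtain ⟨a, rfl⟩ : ∃ a, i = a + n := ⟨i - n, by omega⟩
    simp only [Nat.add_sub_cancel]
    have e : q ^ (2 * (a + n) ^ 2 + 2 * (b + n) ^ 2) / q ^ ((a + n + (b + n)) ^ 2) *
        (q ^ 2) ^ (a * b) = q ^ (a ^ 2) * q ^ (b ^ 2) := by
      have : q ^ ((a + n + (b + n)) ^ 2) ≠ 0 := by positivity
      field_simp
      ring
    calc _ = (q ^ (2 * (a + n) ^ 2 + 2 * (b + n) ^ 2) / q ^ ((a + n + (b + n)) ^ 2) *
        (q ^ 2) ^ (a * b)) * (1 / (qPoch (q ^ 2) (q ^ 2) a * qPoch (q ^ 2) (q ^ 2) b *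
          (qPoch (q ^ 2) (q ^ 2) n * qPoch z (q ^ 2) n)) * (u ^ (a + n) * v ^ (b + n))) := by ring
      _ = _ := by
        rw [e, mul_pow, pow_add, pow_add]
        have := hp a; have := hp b; have := hp n; have := hp' n
        field_simp
  · rw [if_neg (by omega), if_neg (by omega)]
    ring

lemma moment {b z q : ℝ} (hb : 0 < b) (h0 : 0 < q) (h1 : q < 1) (hz0 : 0 < z) (hz1 : z < 1)
    (hbz : b * z = q) (n : ℕ) :
    HasSum (fun k : ℤ => z ^ k * Wt b (q ^ 2) k * ((q ^ 2) ^ k) ^ n)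
      ((∑' k : ℤ, z ^ k * Wt b (q ^ 2) k) * (qPoch z (q ^ 2) n / q ^ (n ^ 2))) := by
  have g0 : 0 < q ^ 2 := by positivity
  have g1 : q ^ 2 < 1 := by nlinarith
  have hzn : ∀ n : ℕ, z * (q ^ 2) ^ n < 1 := fun n => by
    have := qfac_pos hz1 g0 g1 n
    linarith
  have hs := bil_summable b (z * (q ^ 2) ^ n) (q ^ 2) hb g0 g1 (by positivity) (hzn n)
  have hv : ∀ n : ℕ, ∑' k : ℤ, (z * (q ^ 2) ^ n) ^ k * Wt b (q ^ 2) k =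
      (∑' k : ℤ, z ^ k * Wt b (q ^ 2) k) * (qPoch z (q ^ 2) n / q ^ (n ^ 2)) := by
    intro n
    induction n with
    | zero => simp [qPoch]
    | succ n ih =>
      have h := bil_rec b (z * (q ^ 2) ^ n) (q ^ 2) hb g0 g1 (by positivity) (hzn n)
      rw [mul_assoc z, ← pow_succ, ih, ← mul_assoc b, hbz] at h
      rw [h, qPoch_succ, show (n + 1) ^ 2 = n ^ 2 + 1 + 2 * n by ring, pow_add q, pow_add q,
        pow_mul q, pow_one]
      field_simp
  rw [← hv n]
  convert hs.hasSum using 2 with k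
  rw [mul_zpow, ← zpow_natCast, ← zpow_natCast, ← zpow_natCast, ← zpow_mul, ← zpow_mul, ← zpow_mul,
    ← zpow_mul]
  rw [mul_comm k (n : ℤ)]
  ring

lemma fub {g : (ℕ × ℕ) × ℤ → ℝ} (hg : 0 ≤ g) {G : ℕ × ℕ → ℝ} {H : ℤ → ℝ} {L : ℝ}
    (h1 : ∀ p, HasSum (fun k => g (p, k)) (G p)) (h2 : HasSum G L)
    (h3 : ∀ k, HasSum (fun p => g (p, k)) (H k)) : HasSum H L := by
  have hs : Summable g := by
    rw [summable_prod_of_nonneg hg]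
    refine ⟨fun p => (h1 p).summable, ?_⟩
    simpa only [fun p => (h1 p).tsum_eq] using h2.summable
  have hL : HasSum g L := by
    have := hs.hasSum.prod_fiberwise h1
    rw [← this.unique h2]
    exact hs.hasSum
  have hL2 : HasSum (fun x : ℤ × (ℕ × ℕ) => g (x.2, x.1)) L :=
    (Equiv.prodComm ℤ (ℕ × ℕ)).hasSum_iff.2 hL
  exact hL2.prod_fiberwise h3

lemma gen_sum {D : ℕ → ℝ} (hD : ∀ i, 0 ≤ D i) (hDs : ∀ y : ℝ, Summable fun i => D i * y ^ i)
    {μ : ℤ → ℝ} (hμ : ∀ k, 0 ≤ μ k) {Q : ℝ} (hQ : 0 < Q) {M : ℕ → ℝ}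
    (hM : ∀ n : ℕ, HasSum (fun k => μ k * (Q ^ k) ^ n) (M n)) {u v L : ℝ} (hu : 0 ≤ u) (hv : 0 ≤ v)
    (hL : HasSum (fun p : ℕ × ℕ => D p.1 * D p.2 * M (p.1 + p.2) * (u ^ p.1 * v ^ p.2)) L) :
    HasSum (fun k : ℤ => μ k * ((∑' i, D i * (u * Q ^ k) ^ i) * (∑' i, D i * (v * Q ^ k) ^ i))) L := by
  refine fub (g := fun x => μ x.2 * ((D x.1.1 * (u * Q ^ x.2) ^ x.1.1) *
    (D x.1.2 * (v * Q ^ x.2) ^ x.1.2))) ?_ ?_ hL ?_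
  · rintro ⟨⟨i, j⟩, k⟩
    have := hD i
    have := hD j
    have := hμ k
    simp only [Pi.zero_apply]
    positivity
  · rintro ⟨i, j⟩
    have := (hM (i + j)).mul_left (D i * D j * (u ^ i * v ^ j))
    have e : D i * D j * (u ^ i * v ^ j) * M (i + j) =
        D i * D j * M (i + j) * (u ^ i * v ^ j) := by ring
    rw [e] at this
    refine this.congr_fun fun k => ?_
    simp only [mul_pow, pow_add]
    ring
  · intro k
    have s1 := hDs (u * Q ^ k)
    have s2 := hDs (v * Q ^ k)
    have n1 : ∀ w : ℝ, 0 ≤ w → 0 ≤ fun i => D i * (w * Q ^ k) ^ i := by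
      intro w hw i
      have := hD i
      simp only [Pi.zero_apply]
      positivity
    have hs := s1.mul_of_nonneg s2 (n1 u hu) (n1 v hv)
    have h := s1.hasSum.mul s2.hasSum hs
    exact h.mul_left (μ k)

/-- even coefficient -/
def D0 (q z : ℝ) (i : ℕ) : ℝ :=
  q ^ (2 * i ^ 2) / (qPoch (q ^ 2) (q ^ 2) i * qPoch z (q ^ 2) i)

/-- odd coefficient -/
def D1 (q z : ℝ) (i : ℕ) : ℝ :=
  q ^ (2 * i ^ 2 + 2 * i) / (qPoch (q ^ 2) (q ^ 2) i * qPoch z (q ^ 2) (i + 1))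

lemma D0_nonneg {q z : ℝ} (h0 : 0 < q) (h1 : q < 1) (hz1 : z < 1) (i : ℕ) : 0 ≤ D0 q z i := by
  have g0 : 0 < q ^ 2 := by positivity
  have g1 : q ^ 2 < 1 := by nlinarith
  have := qPoch_pos g1 g0 g1 i
  have := qPoch_pos hz1 g0 g1 i
  unfold D0; positivity

lemma D1_nonneg {q z : ℝ} (h0 : 0 < q) (h1 : q < 1) (hz1 : z < 1) (i : ℕ) : 0 ≤ D1 q z i := by
  have g0 : 0 < q ^ 2 := by positivity
  have g1 : q ^ 2 < 1 := by nlinarith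
  have := qPoch_pos g1 g0 g1 i
  have := qPoch_pos hz1 g0 g1 (i + 1)
  unfold D1; positivity

lemma coef_summable {q z : ℝ} (h0 : 0 < q) (h1 : q < 1) (hz0 : 0 < z) (hz1 : z < 1) (m : ℕ)
    {f : ℕ → ℝ} (hf : Summable f) :
    Summable fun i => f i / (qPoch (q ^ 2) (q ^ 2) i * qPoch z (q ^ 2) (i + m)) := by
  have g0 : 0 < q ^ 2 := by positivity
  have g1 : q ^ 2 < 1 := by nlinarith
  refine Summable.of_norm_bounded
    (hf.norm.div_const (qPochInf (q ^ 2) (q ^ 2) * qPochInf z (q ^ 2))) fun i => ?_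
  have p1 := qPoch_pos g1 g0 g1 i
  have p2 := qPoch_pos hz1 g0 g1 (i + m)
  have p3 := qPochInf_pos g1 g0 g1
  have p4 := qPochInf_pos hz1 g0 g1
  rw [norm_div, Real.norm_of_nonneg (mul_pos p1 p2).le]
  refine div_le_div_of_nonneg_left (norm_nonneg _) (by positivity) ?_
  exact mul_le_mul (qPochInf_le g0.le g1 g0 g1 i) (qPochInf_le hz0.le hz1 g0 g1 _) p4.le p1.le

lemma coef_summable1 {q : ℝ} (h0 : 0 < q) (h1 : q < 1)
    {f : ℕ → ℝ} (hf : Summable f) :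
    Summable fun i => f i / qPoch (q ^ 2) (q ^ 2) i := by
  have g0 : 0 < q ^ 2 := by positivity
  have g1 : q ^ 2 < 1 := by nlinarith
  refine Summable.of_norm_bounded
    (hf.norm.div_const (qPochInf (q ^ 2) (q ^ 2))) fun i => ?_
  have p1 := qPoch_pos g1 g0 g1 i
  have p3 := qPochInf_pos g1 g0 g1
  rw [norm_div, Real.norm_of_nonneg p1.le]
  exact div_le_div_of_nonneg_left (norm_nonneg _) (by positivity) (qPochInf_le g0.le g1 g0 g1 i)

lemma D0_summable {q z : ℝ} (h0 : 0 < q) (h1 : q < 1) (hz0 : 0 < z) (hz1 : z < 1) (y : ℝ) :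
    Summable fun i => D0 q z i * y ^ i := by
  have g0 : 0 < q ^ 2 := by positivity
  have g1 : q ^ 2 < 1 := by nlinarith
  refine (coef_summable h0 h1 hz0 hz1 0 (gauss_summable g0 g1 y)).congr fun i => ?_
  simp only [D0, add_zero, pow_mul]
  ring

lemma D1_summable {q z : ℝ} (h0 : 0 < q) (h1 : q < 1) (hz0 : 0 < z) (hz1 : z < 1) (y : ℝ) :
    Summable fun i => D1 q z i * y ^ i := by
  have g0 : 0 < q ^ 2 := by positivity
  have g1 : q ^ 2 < 1 := by nlinarith
  refine (coef_summable h0 h1 hz0 hz1 1 (gauss_summable g0 g1 (q ^ 2 * y))).congr fun i => ?_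
  simp only [D1, pow_mul, pow_add, mul_pow]
  ring

lemma even_sum {b z q u v A B C : ℝ} (hb : 0 < b) (h0 : 0 < q) (h1 : q < 1) (hz0 : 0 < z)
    (hz1 : z < 1) (hbz : b * z = q) (hu : 0 ≤ u) (hv : 0 ≤ v)
    (hA : HasSum (fun k : ℕ => q ^ (k ^ 2) / qPoch (q ^ 2) (q ^ 2) k * u ^ k) A)
    (hB : HasSum (fun k : ℕ => q ^ (k ^ 2) / qPoch (q ^ 2) (q ^ 2) k * v ^ k) B)
    (hC : HasSum (fun k : ℕ => (u * v) ^ k / (qPoch (q ^ 2) (q ^ 2) k * qPoch z (q ^ 2) k)) C) :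
    HasSum (fun k : ℤ => z ^ k * Wt b (q ^ 2) k * ((∑' i, D0 q z i * (u * (q ^ 2) ^ k) ^ i) *
      (∑' i, D0 q z i * (v * (q ^ 2) ^ k) ^ i)))
      ((∑' k : ℤ, z ^ k * Wt b (q ^ 2) k) * (A * B * C)) := by
  have g0 : 0 < q ^ 2 := by positivity
  have g1 : q ^ 2 < 1 := by nlinarith
  refine gen_sum (D0_nonneg h0 h1 hz1) (D0_summable h0 h1 hz0 hz1)
    (fun k => mul_nonneg (by positivity) (Wt_pos b _ hb g0 g1 k).le) g0
    (moment hb h0 h1 hz0 hz1 hbz) hu hv ?_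
  have := (star_hasSum h0 h1 hz1 hu hv hA hB hC).mul_left (∑' k : ℤ, z ^ k * Wt b (q ^ 2) k)
  refine this.congr_fun fun p => ?_
  simp only [D0, pow_add]
  ring

lemma odd_sum {b z q u v A B C : ℝ} (hb : 0 < b) (h0 : 0 < q) (h1 : q < 1) (hz0 : 0 < z)
    (hz1 : z < 1) (hbz : b * z = q) (hu : 0 ≤ u) (hv : 0 ≤ v)
    (hA : HasSum (fun k : ℕ => q ^ (k ^ 2) / qPoch (q ^ 2) (q ^ 2) k * u ^ k) A)
    (hB : HasSum (fun k : ℕ => q ^ (k ^ 2) / qPoch (q ^ 2) (q ^ 2) k * v ^ k) B)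
    (hC : HasSum
      (fun k : ℕ => (u * v) ^ k / (qPoch (q ^ 2) (q ^ 2) k * qPoch z (q ^ 2) (k + 1))) C) :
    HasSum (fun k : ℤ => q * (q ^ 2) ^ k * (z ^ k * Wt b (q ^ 2) k) *
      ((∑' i, D1 q z i * (u * (q ^ 2) ^ k) ^ i) *
      (∑' i, D1 q z i * (v * (q ^ 2) ^ k) ^ i)))
      ((∑' k : ℤ, z ^ k * Wt b (q ^ 2) k) * (A * B * C)) := by
  have g0 : 0 < q ^ 2 := by positivity
  have g1 : q ^ 2 < 1 := by nlinarith
  have hz' : 1 - z ≠ 0 := by linarith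
  have hM : ∀ n : ℕ, HasSum (fun k : ℤ => q * (q ^ 2) ^ k * (z ^ k * Wt b (q ^ 2) k) *
      ((q ^ 2) ^ k) ^ n) (q * ((∑' k : ℤ, z ^ k * Wt b (q ^ 2) k) *
      (qPoch z (q ^ 2) (n + 1) / q ^ ((n + 1) ^ 2)))) := by
    intro n
    refine ((moment hb h0 h1 hz0 hz1 hbz (n + 1)).mul_left q).congr_fun fun k => ?_
    rw [pow_succ]
    ring
  refine gen_sum (D1_nonneg h0 h1 hz1) (D1_summable h0 h1 hz0 hz1)
    (fun k => mul_nonneg (by positivity) (mul_nonneg (by positivity) (Wt_pos b _ hb g0 g1 k).le)) g0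
    hM hu hv ?_
  have hC' : HasSum (fun k : ℕ => (u * v) ^ k /
      (qPoch (q ^ 2) (q ^ 2) k * qPoch (z * q ^ 2) (q ^ 2) k)) ((1 - z) * C) := by
    refine (hC.mul_left (1 - z)).congr_fun fun k => ?_
    rw [qPoch_succ']
    have := (qPoch_pos g1 g0 g1 k).ne'
    have := (qPoch_pos (show z * q ^ 2 < 1 by nlinarith) g0 g1 k).ne'
    field_simp
  have := (star_hasSum h0 h1 (show z * q ^ 2 < 1 by nlinarith) hu hv hA hB hC').mul_left
    ((∑' k : ℤ, z ^ k * Wt b (q ^ 2) k) / (1 - z))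
  have e : (∑' k : ℤ, z ^ k * Wt b (q ^ 2) k) / (1 - z) * (A * B * ((1 - z) * C)) =
    (∑' k : ℤ, z ^ k * Wt b (q ^ 2) k) * (A * B * C) := by field_simp
  rw [e] at this
  refine this.congr_fun fun p => ?_
  obtain ⟨i, j⟩ := p
  simp only [D1, qPoch_succ' z]
  have := (qPoch_pos g1 g0 g1 i).ne'
  have := (qPoch_pos g1 g0 g1 j).ne'
  have := (qPoch_pos (show z * q ^ 2 < 1 by nlinarith) g0 g1 i).ne'
  have := (qPoch_pos (show z * q ^ 2 < 1 by nlinarith) g0 g1 j).ne'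
  rw [show (i + j + 1) ^ 2 = (i + j) ^ 2 + (2 * i + 2 * j + 1) by ring, pow_add q ((i + j) ^ 2)]
  rw [pow_add q (2 * i ^ 2), pow_add q (2 * i ^ 2), pow_add q (2 * j ^ 2), pow_add q (2 * i + 2 * j),
    pow_add q (2 * i)]
  field_simp

lemma zpar {q α : ℝ} (h0 : 0 < q) (h1 : q < 1) (hα : -1 < α) :
    0 < q ^ (2 * α + 2) ∧ q ^ (2 * α + 2) < 1 :=
  ⟨by positivity, Real.rpow_lt_one h0.le h1 (by linarith)⟩

lemma qPochAlpha_succ (q α : ℝ) (n : ℕ) :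
    qPochAlpha q α (n + 1) = qPochAlpha q α n * ((1 - q) * qNumAlpha q α (n + 1)) := by
  simp only [qPochAlpha, qFactAlpha, Finset.prod_range_succ, pow_succ]
  ring

lemma qNum_odd {q α : ℝ} (h0 : 0 < q) (h1 : q < 1) (i : ℕ) :
    (1 - q) * qNumAlpha q α (2 * i + 1) = 1 - q ^ (2 * α + 2) * (q ^ 2) ^ i := by
  have : 1 - q ≠ 0 := by linarith
  rw [qNumAlpha, if_neg (by omega), qNumber]
  have e : q ^ (((2 * i + 1 : ℕ) : ℝ) + 2 * α + 1) = q ^ (2 * α + 2) * (q ^ 2) ^ i := by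
    rw [← pow_mul, ← Real.rpow_natCast, ← Real.rpow_add h0]
    congr 1
    push_cast
    ring
  rw [e]
  field_simp

lemma qNum_even {q α : ℝ} (h1 : q < 1) (i : ℕ) :
    (1 - q) * qNumAlpha q α (2 * i + 1 + 1) = 1 - q ^ 2 * (q ^ 2) ^ i := by
  have : 1 - q ≠ 0 := by linarith
  rw [qNumAlpha, if_pos (by omega), qNumber, Real.rpow_natCast]
  have e : q ^ (2 * i + 1 + 1) = q ^ 2 * (q ^ 2) ^ i := by ring
  rw [e]
  field_simp

lemma qPochAlpha_even {q α : ℝ} (h0 : 0 < q) (h1 : q < 1) (i : ℕ) :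
    qPochAlpha q α (2 * i) = qPoch (q ^ 2) (q ^ 2) i * qPoch (q ^ (2 * α + 2)) (q ^ 2) i := by
  induction i with
  | zero => simp [qPochAlpha, qFactAlpha, qPoch]
  | succ i ih =>
    rw [show 2 * (i + 1) = 2 * i + 1 + 1 by ring, qPochAlpha_succ, qPochAlpha_succ, ih,
      qNum_odd h0 h1, qNum_even h1, qPoch_succ, qPoch_succ]
    ring

lemma qPochAlpha_odd {q α : ℝ} (h0 : 0 < q) (h1 : q < 1) (i : ℕ) :
    qPochAlpha q α (2 * i + 1) =
      qPoch (q ^ 2) (q ^ 2) i * qPoch (q ^ (2 * α + 2)) (q ^ 2) (i + 1) := by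
  rw [qPochAlpha_succ, qPochAlpha_even h0 h1, qNum_odd h0 h1, qPoch_succ]
  ring

lemma qPochAlpha_pos {q α : ℝ} (h0 : 0 < q) (h1 : q < 1) (hα : -1 < α) (n : ℕ) :
    0 < qPochAlpha q α n := by
  have g0 : 0 < q ^ 2 := by positivity
  have g1 : q ^ 2 < 1 := by nlinarith
  have hz := zpar h0 h1 hα
  rcases Nat.even_or_odd' n with ⟨i, rfl | rfl⟩
  · rw [qPochAlpha_even h0 h1]
    exact mul_pos (qPoch_pos g1 g0 g1 i) (qPoch_pos hz.2 g0 g1 i)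
  · rw [qPochAlpha_odd h0 h1]
    exact mul_pos (qPoch_pos g1 g0 g1 i) (qPoch_pos hz.2 g0 g1 (i + 1))

lemma qFactAlpha_pos {q α : ℝ} (h0 : 0 < q) (h1 : q < 1) (hα : -1 < α) (n : ℕ) :
    0 < qFactAlpha q α n := by
  have h := qPochAlpha_pos h0 h1 hα n
  rw [qPochAlpha] at h
  have : 0 < (1 - q) ^ n := pow_pos (by linarith) n
  exact (pos_iff_pos_of_mul_pos h).1 this

lemma qexp_id {q : ℝ} (h0 : 0 < q) (m k : ℕ) :
    q ^ ((((m + 2 * k : ℕ) : ℝ) ^ 2) / 2) *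
      q ^ ((k * (2 * k + 1) : ℤ) - (2 * (m + 2 * k : ℕ) * k : ℤ)) =
    q ^ (((m : ℝ) ^ 2) / 2) * q ^ k := by
  rw [← Real.rpow_intCast, ← Real.rpow_natCast q k, ← Real.rpow_add h0, ← Real.rpow_add h0]
  congr 1
  push_cast
  ring

lemma term_eq {q α : ℝ} (h0 : 0 < q) (h1 : q < 1) (hα : -1 < α) (ζ x : ℝ) (n : ℕ) :
    ζ ^ n / Real.sqrt (qFactAlpha q α n) * phiQ q α n x =
    cAlpha q α * Real.sqrt (omegaAlpha q α x) * ∑ k ∈ Finset.range (n / 2 + 1),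
      ((-q) ^ k / qPoch (q ^ 2) (q ^ 2) k * ((1 - q) * ζ ^ 2) ^ k) *
      (q ^ ((((n - 2 * k : ℕ) : ℝ) ^ 2) / 2) * (Real.sqrt (1 - q) * ζ * x) ^ (n - 2 * k) /
        qPochAlpha q α (n - 2 * k)) := by
  have hF := qFactAlpha_pos h0 h1 hα n
  have hP : qPoch q q n ≠ 0 := (qPoch_pos h1 h0 h1 n).ne'
  have h1q : 0 ≤ 1 - q := by linarith
  have hsq : Real.sqrt (qPochAlpha q α n) = Real.sqrt (1 - q) ^ n * Real.sqrt (qFactAlpha q α n) := by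
    rw [qPochAlpha, Real.sqrt_mul (by positivity)]
    congr 1
    rw [Real.sqrt_eq_iff_mul_self_eq (by positivity) (by positivity), ← mul_pow,
      Real.mul_self_sqrt h1q]
  have hsF : Real.sqrt (qFactAlpha q α n) ≠ 0 := (Real.sqrt_pos.2 hF).ne'
  rw [phiQ, dAlpha, hTilde, hsq]
  calc _ = cAlpha q α * Real.sqrt (omegaAlpha q α x) * ((q ^ (((n : ℝ) ^ 2) / 2) *
        (Real.sqrt (1 - q) * ζ) ^ n) * ∑ k ∈ Finset.range (n / 2 + 1),
          (-1 : ℝ) ^ k * q ^ ((k * (2 * k + 1) : ℤ) - (2 * n * k : ℤ)) * x ^ (n - 2 * k) /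
          (qPoch (q ^ 2) (q ^ 2) k * qPochAlpha q α (n - 2 * k))) := by
        rw [mul_pow]
        field_simp
    _ = _ := by
        congr 1
        rw [Finset.mul_sum]
        apply Finset.sum_congr rfl
        intro k hk
        have hk' : 2 * k ≤ n := by have := Finset.mem_range.1 hk; omega
        obtain ⟨m, rfl⟩ : ∃ m, n = m + 2 * k := ⟨n - 2 * k, by omega⟩
        rw [Nat.add_sub_cancel]
        have e := qexp_id h0 m k
        have es : (Real.sqrt (1 - q) * ζ) ^ (m + 2 * k) =
            (Real.sqrt (1 - q) * ζ) ^ m * ((1 - q) * ζ ^ 2) ^ k := by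
          rw [pow_add, pow_mul, mul_pow _ _ 2, Real.sq_sqrt h1q]
        rw [es]
        calc _ = (q ^ ((((m + 2 * k : ℕ) : ℝ) ^ 2) / 2) *
              q ^ ((k * (2 * k + 1) : ℤ) - (2 * (m + 2 * k : ℕ) * k : ℤ))) *
              ((Real.sqrt (1 - q) * ζ) ^ m * ((1 - q) * ζ ^ 2) ^ k * (-1) ^ k * x ^ m /
              (qPoch (q ^ 2) (q ^ 2) k * qPochAlpha q α m)) := by ring
          _ = _ := by
            rw [e, neg_pow q, mul_pow _ x]
            ring

lemma conv2 {a b : ℕ → ℝ} (ha : Summable a) (hb : Summable b) :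
    HasSum (fun n => ∑ k ∈ Finset.range (n / 2 + 1), a k * b (n - 2 * k))
      ((∑' k, a k) * ∑' k, b k) := by
  have h := ha.hasSum.mul hb.hasSum (summable_mul_of_summable_norm ha.norm hb.norm)
  set g : ℕ × ℕ → ℝ := fun x => if 2 * x.2 ≤ x.1 then a x.2 * b (x.1 - 2 * x.2) else 0 with hg
  set m : ℕ × ℕ → ℕ × ℕ := fun x => (x.2 + 2 * x.1, x.1) with hm
  have hinj : Function.Injective m := by
    rintro ⟨i, j⟩ ⟨i', j'⟩ h
    simp only [hm, Prod.mk.injEq] at h ⊢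
    omega
  have hgm : HasSum g ((∑' k, a k) * ∑' k, b k) := by
    rw [← hinj.hasSum_iff]
    · refine h.congr_fun ?_
      intro x
      simp [hg, hm]
    · rintro ⟨n, k⟩ hx
      simp only [hg]
      rw [if_neg]
      intro hk
      apply hx
      have hk' : 2 * k ≤ n := hk
      refine ⟨(k, n - 2 * k), ?_⟩
      simp only [hm]
      rw [Nat.sub_add_cancel hk']
  refine hgm.prod_fiberwise ?_
  intro n
  have hfin := hasSum_sum_of_ne_finset_zero (f := fun k => g (n, k))
    (s := Finset.range (n / 2 + 1)) (L := .unconditional ℕ) (by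
      intro k hk
      simp only [Finset.mem_range, not_lt] at hk
      simp only [hg]
      rw [if_neg (by omega)])
  convert hfin using 1
  apply Finset.sum_congr rfl
  intro k hk
  have := Finset.mem_range.1 hk
  simp only [hg]
  rw [if_pos (by omega)]

lemma Em_hasSum {q α : ℝ} (h0 : 0 < q) (h1 : q < 1) (hα : -1 < α) (y : ℝ) :
    HasSum (fun m : ℕ => q ^ (((m : ℝ) ^ 2) / 2) * y ^ m / qPochAlpha q α m)
      ((∑' i, D0 q (q ^ (2 * α + 2)) i * (y ^ 2) ^ i) +
        Real.sqrt q * y * ∑' i, D1 q (q ^ (2 * α + 2)) i * (y ^ 2) ^ i) := by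
  obtain ⟨hz0, hz1⟩ := zpar h0 h1 hα
  refine HasSum.even_add_odd ?_ ?_
  · refine (D0_summable h0 h1 hz0 hz1 (y ^ 2)).hasSum.congr_fun fun i => ?_
    rw [qPochAlpha_even h0 h1, D0]
    have : q ^ ((((2 * i : ℕ) : ℝ) ^ 2) / 2) = q ^ (2 * i ^ 2) := by
      rw [← Real.rpow_natCast q (2 * i ^ 2)]
      congr 1
      push_cast
      ring
    rw [this, pow_mul y]
    ring
  · refine ((D1_summable h0 h1 hz0 hz1 (y ^ 2)).hasSum.mul_left (Real.sqrt q * y)).congr_fun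
      fun i => ?_
    rw [qPochAlpha_odd h0 h1, D1]
    have : q ^ ((((2 * i + 1 : ℕ) : ℝ) ^ 2) / 2) = q ^ (2 * i ^ 2 + 2 * i) * Real.sqrt q := by
      rw [← Real.rpow_natCast q (2 * i ^ 2 + 2 * i), Real.sqrt_eq_rpow, ← Real.rpow_add h0]
      congr 1
      push_cast
      ring
    rw [this, pow_succ y, pow_mul y]
    ring

lemma e_summable {q u : ℝ} (h0 : 0 < q) (h1 : q < 1) (hu : 0 ≤ u) (hqu : q * u < 1) :
    Summable fun k : ℕ => (-q) ^ k / qPoch (q ^ 2) (q ^ 2) k * u ^ k := by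
  have : Summable fun k : ℕ => (-(q * u)) ^ k := by
    apply summable_geometric_of_abs_lt_one
    rw [abs_neg, abs_of_nonneg (by positivity)]
    exact hqu
  refine (coef_summable1 h0 h1 this).congr fun k => ?_
  rw [← neg_mul, mul_pow]
  ring

lemma coherent_eq {q α : ℝ} (h0 : 0 < q) (h1 : q < 1) (hα : -1 < α) (ζ x : ℝ)
    (h2 : q * (1 - q) * ζ ^ 2 < 1) :
    coherentF q α ζ x = cAlpha q α * Real.sqrt (omegaAlpha q α x) *
      ((∑' k : ℕ, (-q) ^ k / qPoch (q ^ 2) (q ^ 2) k * ((1 - q) * ζ ^ 2) ^ k) *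
      ((∑' i, D0 q (q ^ (2 * α + 2)) i * ((1 - q) * ζ ^ 2 * x ^ 2) ^ i) +
        Real.sqrt q * (Real.sqrt (1 - q) * ζ * x) *
          ∑' i, D1 q (q ^ (2 * α + 2)) i * ((1 - q) * ζ ^ 2 * x ^ 2) ^ i)) := by
  have h1q : 0 ≤ 1 - q := by linarith
  have hu : 0 ≤ (1 - q) * ζ ^ 2 := by positivity
  have hE := Em_hasSum h0 h1 hα (Real.sqrt (1 - q) * ζ * x)
  have hy : (Real.sqrt (1 - q) * ζ * x) ^ 2 = (1 - q) * ζ ^ 2 * x ^ 2 := by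
    rw [mul_pow, mul_pow, Real.sq_sqrt h1q]
  rw [hy] at hE
  have hc := conv2 (e_summable h0 h1 hu (by linarith)) hE.summable
  rw [hE.tsum_eq] at hc
  have := hc.mul_left (cAlpha q α * Real.sqrt (omegaAlpha q α x))
  rw [← this.tsum_eq, coherentF]
  exact tsum_congr fun n => term_eq h0 h1 hα ζ x n

lemma omega_eq {q α : ℝ} (k : ℤ) {x : ℝ} (hx : x ^ 2 = (q ^ 2) ^ k) :
    omegaAlpha q α x = Wt (q ^ (-(2 * α + 1))) (q ^ 2) k := by
  rw [omegaAlpha, Wt, qPochInf, hx]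
  congr 1
  apply tprod_congr
  intro n
  rw [pow_mul]
  ring

lemma cAlpha_sq {q α : ℝ} (h0 : 0 < q) (h1 : q < 1) (hα : -1 < α) :
    cAlpha q α ^ 2 * (2 * (1 - q)) *
      ∑' k : ℤ, (q ^ (2 * α + 2)) ^ k * Wt (q ^ (-(2 * α + 1))) (q ^ 2) k = 1 := by
  have g0 : 0 < q ^ 2 := by positivity
  have g1 : q ^ 2 < 1 := by nlinarith
  obtain ⟨hz0, hz1⟩ := zpar h0 h1 hα
  have hb : 0 < q ^ (-(2 * α + 1)) := by positivity
  have hbz : q ^ (-(2 * α + 1)) * q ^ (2 * α + 2) = q := by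
    rw [← Real.rpow_add h0]
    conv_rhs => rw [← Real.rpow_one q]
    congr 1
    ring
  have hqb : q ^ 2 / q ^ (-(2 * α + 1)) = q ^ (2 * α + 3) := by
    rw [← Real.rpow_natCast, ← Real.rpow_sub h0]
    congr 1
    push_cast
    ring
  have hqq : q ^ 2 / q = q := by field_simp
  rw [bil_val _ _ _ hb g0 g1 hz0 hz1, hbz, hqb, hqq]
  have p1 := one_le_qPochInf hb.le g0 g1
  have p2 := one_le_qPochInf (b := q ^ (2 * α + 3)) (by positivity) g0 g1
  have p3 := one_le_qPochInf h0.le g0 g1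
  have p4 := qPochInf_pos hz1 g0 g1
  have p5 := qPochInf_pos g1 g0 g1
  have h1q : 0 < 1 - q := by linarith
  rw [cAlpha, Real.sq_sqrt (by positivity)]
  generalize qPochInf (-q ^ (-(2 * α + 1))) (q ^ 2) = x1 at *
  generalize qPochInf (-q ^ (2 * α + 3)) (q ^ 2) = x2 at *
  generalize qPochInf (-q) (q ^ 2) = x3 at *
  generalize qPochInf (q ^ (2 * α + 2)) (q ^ 2) = x4 at *
  generalize qPochInf (q ^ 2) (q ^ 2) = x5 at *
  have : x1 ≠ 0 := by linarith
  have : x2 ≠ 0 := by linarith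
  have : x3 ≠ 0 := by linarith
  field_simp

lemma gauss_hasSum {q : ℝ} (h0 : 0 < q) (h1 : q < 1) (u : ℝ) :
    Summable fun k : ℕ => q ^ (k ^ 2) / qPoch (q ^ 2) (q ^ 2) k * u ^ k :=
  (coef_summable1 h0 h1 (gauss_summable h0 h1 u)).congr fun k => by ring

/-- overlap of unnormalized q-coherent states. -/
theorem stmt_12 (q α : ℝ) (hq0 : 0 < q) (hq1 : q < 1) (hα : -1 < α)
    (ζ ζ' : ℝ) (h1 : (1 - q) * |ζ * ζ'| < 1)
    (h2 : q * (1 - q) * ζ ^ 2 < 1) (h3 : q * (1 - q) * ζ' ^ 2 < 1) :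
    HasSum (fun k : ℤ => (1 - q) * q ^ ((k : ℝ) * (2 * α + 2)) *
        (coherentF q α ζ (q ^ k) * coherentF q α ζ' (q ^ k) +
          coherentF q α ζ (-(q ^ k)) * coherentF q α ζ' (-(q ^ k))))
      (∑' n : ℕ, (ζ * ζ') ^ n / qFactAlpha q α n) ∧
    (∑' n : ℕ, (ζ * ζ') ^ n / qFactAlpha q α n) = eExpAlpha q α ((1 - q) * (ζ * ζ')) := by
  have h1q : 0 < 1 - q := by linarith
  have second : (∑' n : ℕ, (ζ * ζ') ^ n / qFactAlpha q α n) =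
      eExpAlpha q α ((1 - q) * (ζ * ζ')) := by
    rw [eExpAlpha]
    apply tsum_congr
    intro n
    rw [qPochAlpha, mul_pow (1 - q) (ζ * ζ') n, mul_div_mul_left _ _ (pow_pos h1q n).ne']
  refine ⟨?_, second⟩
  rw [second, eExpAlpha]
  have g0 : 0 < q ^ 2 := by positivity
  have g1 : q ^ 2 < 1 := by nlinarith
  obtain ⟨hz0, hz1⟩ := zpar hq0 hq1 hα
  have hb : 0 < q ^ (-(2 * α + 1)) := by positivity
  have hbz : q ^ (-(2 * α + 1)) * q ^ (2 * α + 2) = q := by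
    rw [← Real.rpow_add hq0]
    conv_rhs => rw [← Real.rpow_one q]
    congr 1
    ring
  have hc := cAlpha_sq hq0 hq1 hα
  have hcoh := fun x => coherent_eq hq0 hq1 hα ζ x h2
  have hcoh' := fun x => coherent_eq hq0 hq1 hα ζ' x h3
  set τ : ℝ := (1 - q) * (ζ * ζ') with hτ
  have hτ1 : |τ| < 1 := by rw [hτ, abs_mul, abs_of_pos h1q]; exact h1
  set u : ℝ := (1 - q) * ζ ^ 2 with hu
  set v : ℝ := (1 - q) * ζ' ^ 2 with hv
  have hu0 : 0 ≤ u := by positivity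
  have hv0 : 0 ≤ v := by positivity
  have huv : u * v = τ ^ 2 := by rw [hu, hv, hτ]; ring
  have huv1 : u * v < 1 := by
    rw [huv, ← sq_abs]
    have := abs_nonneg τ
    nlinarith
  have hgeo : Summable fun k : ℕ => (u * v) ^ k :=
    summable_geometric_of_lt_one (by positivity) huv1
  have sA := gauss_hasSum hq0 hq1 u
  have sB := gauss_hasSum hq0 hq1 v
  have eA := euler_mul hq0 hq1 (e_summable hq0 hq1 hu0 (by rw [hu]; linarith)) sA
  have eB := euler_mul hq0 hq1 (e_summable hq0 hq1 hv0 (by rw [hv]; linarith)) sB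
  have sC0 := coef_summable hq0 hq1 hz0 hz1 0 hgeo
  have sC1 := coef_summable hq0 hq1 hz0 hz1 1 hgeo
  simp only [add_zero] at sC0
  have hE := even_sum hb hq0 hq1 hz0 hz1 hbz hu0 hv0 sA.hasSum sB.hasSum sC0.hasSum
  have hO := odd_sum hb hq0 hq1 hz0 hz1 hbz hu0 hv0 sA.hasSum sB.hasSum sC1.hasSum
  have hR : HasSum (fun n : ℕ => τ ^ n / qPochAlpha q α n)
      ((∑' k : ℕ, (u * v) ^ k / (qPoch (q ^ 2) (q ^ 2) k * qPoch (q ^ (2 * α + 2)) (q ^ 2) k)) +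
      τ * ∑' k : ℕ, (u * v) ^ k /
        (qPoch (q ^ 2) (q ^ 2) k * qPoch (q ^ (2 * α + 2)) (q ^ 2) (k + 1))) := by
    refine HasSum.even_add_odd ?_ ?_
    · refine sC0.hasSum.congr_fun fun k => ?_
      rw [qPochAlpha_even hq0 hq1, huv, pow_mul]
    · refine (sC1.hasSum.mul_left τ).congr_fun fun k => ?_
      rw [qPochAlpha_odd hq0 hq1, huv, pow_succ, pow_mul]
      ring
  rw [hR.tsum_eq]
  set eu : ℝ := ∑' k : ℕ, (-q) ^ k / qPoch (q ^ 2) (q ^ 2) k * u ^ k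
  set ev : ℝ := ∑' k : ℕ, (-q) ^ k / qPoch (q ^ 2) (q ^ 2) k * v ^ k
  set A : ℝ := ∑' k : ℕ, q ^ (k ^ 2) / qPoch (q ^ 2) (q ^ 2) k * u ^ k
  set B : ℝ := ∑' k : ℕ, q ^ (k ^ 2) / qPoch (q ^ 2) (q ^ 2) k * v ^ k
  set C0 : ℝ := ∑' k : ℕ, (u * v) ^ k /
    (qPoch (q ^ 2) (q ^ 2) k * qPoch (q ^ (2 * α + 2)) (q ^ 2) k)
  set C1 : ℝ := ∑' k : ℕ, (u * v) ^ k /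
    (qPoch (q ^ 2) (q ^ 2) k * qPoch (q ^ (2 * α + 2)) (q ^ 2) (k + 1))
  set S : ℝ := ∑' k : ℤ, (q ^ (2 * α + 2)) ^ k * Wt (q ^ (-(2 * α + 1))) (q ^ 2) k
  have hT := ((hE.add (hO.mul_left τ)).mul_left (2 * (1 - q) * cAlpha q α ^ 2 * (eu * ev)))
  have eT : 2 * (1 - q) * cAlpha q α ^ 2 * (eu * ev) *
      (S * (A * B * C0) + τ * (S * (A * B * C1))) = C0 + τ * C1 := by
    calc _ = (cAlpha q α ^ 2 * (2 * (1 - q)) * S) * (eu * A) * (ev * B) * (C0 + τ * C1) := by ring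
      _ = _ := by rw [hc, eA, eB]; ring
  rw [eT] at hT
  refine hT.congr_fun fun k => ?_
  have hx : (q ^ k) ^ 2 = (q ^ 2) ^ k := by
    rw [← zpow_natCast, ← zpow_natCast, ← zpow_mul, ← zpow_mul, mul_comm]
  have hx' : (-(q ^ k)) ^ 2 = (q ^ 2) ^ k := by rw [neg_sq, hx]
  have hW := Wt_pos (q ^ (-(2 * α + 1))) (q ^ 2) hb g0 g1 k
  have hzk : q ^ ((k : ℝ) * (2 * α + 2)) = (q ^ (2 * α + 2)) ^ k := by
    rw [mul_comm, Real.rpow_mul hq0.le, Real.rpow_intCast]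
  rw [hcoh, hcoh', hcoh, hcoh', omega_eq k hx, omega_eq k hx', hx, hx', hzk]
  have hsW := Real.sq_sqrt hW.le
  have hsq := Real.sq_sqrt hq0.le
  have hs1 := Real.sq_sqrt h1q.le
  set w := Real.sqrt (Wt (q ^ (-(2 * α + 1))) (q ^ 2) k)
  set r := Real.sqrt q
  set s := Real.sqrt (1 - q)
  rw [← hsW, hτ]
  set E0 := ∑' i, D0 q (q ^ (2 * α + 2)) i * (u * (q ^ 2) ^ k) ^ i
  set F0 := ∑' i, D0 q (q ^ (2 * α + 2)) i * (v * (q ^ 2) ^ k) ^ i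
  set E1 := ∑' i, D1 q (q ^ (2 * α + 2)) i * (u * (q ^ 2) ^ k) ^ i
  set F1 := ∑' i, D1 q (q ^ (2 * α + 2)) i * (v * (q ^ 2) ^ k) ^ i
  generalize (q ^ (2 * α + 2)) ^ k = zk
  rw [← hx]
  generalize q ^ k = X
  have hrs : r ^ 2 * s ^ 2 = q * (1 - q) := by rw [hsq, hs1]
  calc _ = 2 * (1 - q) * zk * cAlpha q α ^ 2 * w ^ 2 * (eu * ev) *
      (E0 * F0 + (r ^ 2 * s ^ 2) * (ζ * ζ') * X ^ 2 * (E1 * F1)) := by ring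
    _ = _ := by rw [hrs]; ring
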